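/- Let $n_1,n_2\in\mathbb{Z}$ and $1<p<\infty$. The biparameter shifted maximal operator $M_{n_1}M_{n_2}f(x,y):=\sup\frac{1}{|I_{n_1}|\,|J_{n_2}|}\int_{I_{n_1}\times J_{n_2}}|f(u,v)|\,du\,dv$, the supremum taken over all dyadic rectangles $I\times J$ with $(x,y)\in I\times J$, is bounded on $L^p(\mathbb{R}^2)$ with operator norm at most $C_p\,\log^2\langle n_1\rangle\,\log^2\langle n_2\rangle$, where $C_p$ depends only on $p$. -/

import Mathlib

open MeasureTheory ENNReal

/-- The biparameter shifted maximal operator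
`M_{n₁}M_{n₂} f(x,y) = sup_{(x,y) ∈ I×J dyadic} |I_{n₁}×J_{n₂}|⁻¹ ∫_{I_{n₁}×J_{n₂}} |f|`,
where `I_m = I + m|I|` and dyadic intervals are `[2^k m, 2^k(m+1))`. -/
noncomputable def biShiftedMaximal (n₁ n₂ : ℤ) (f : ℝ × ℝ → ℂ) (z : ℝ × ℝ) : ℝ≥0∞ :=
  ⨆ (k₁ : ℤ) (m₁ : ℤ) (k₂ : ℤ) (m₂ : ℤ)
    (_ : z.1 ∈ Set.Ico ((2:ℝ)^k₁ * m₁) ((2:ℝ)^k₁ * (m₁+1)))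
    (_ : z.2 ∈ Set.Ico ((2:ℝ)^k₂ * m₂) ((2:ℝ)^k₂ * (m₂+1))),
    (ENNReal.ofReal ((2:ℝ)^k₁ * (2:ℝ)^k₂))⁻¹ *
      ∫⁻ y in (Set.Ico ((2:ℝ)^k₁ * (m₁+n₁)) ((2:ℝ)^k₁ * (m₁+n₁+1))) ×ˢ
          (Set.Ico ((2:ℝ)^k₂ * (m₂+n₂)) ((2:ℝ)^k₂ * (m₂+n₂+1))), (‖f y‖₊ : ℝ≥0∞)


namespace BiShift

noncomputable def avg (g : ℝ → ℝ≥0∞) (k m : ℤ) : ℝ≥0∞ :=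
  (ENNReal.ofReal ((2:ℝ)^k))⁻¹ * ∫⁻ u in Set.Ico ((2:ℝ)^k * m) ((2:ℝ)^k * (m+1)), g u

lemma two_zpow_pos (k : ℤ) : (0:ℝ) < (2:ℝ)^k := by positivity

lemma mem_Ico_iff (x : ℝ) (k m : ℤ) :
    x ∈ Set.Ico ((2:ℝ)^k * m) ((2:ℝ)^k * (m+1)) ↔ ⌊x / (2:ℝ)^k⌋ = m := by
  have h := two_zpow_pos k
  rw [Int.floor_eq_iff, Set.mem_Ico, le_div_iff₀ h, div_lt_iff₀ h, mul_comm, mul_comm ((2:ℝ)^k)]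

lemma floor_nest (x : ℝ) (k : ℤ) (i : ℕ) :
    ⌊x / (2:ℝ)^(k + (i:ℤ))⌋ = ⌊x / (2:ℝ)^k⌋ / (2 ^ i : ℤ) := by
  have h : x / (2:ℝ)^(k + (i:ℤ)) = x / (2:ℝ)^k / ((2 ^ i : ℕ) : ℝ) := by
    rw [zpow_add₀ (by norm_num), div_div]; push_cast; rfl
  rw [h, Int.floor_div_natCast]; push_cast; rfl

def dset (j : ℤ) (S : Set ℤ) : Set ℝ := {x | ⌊x / (2:ℝ)^j⌋ ∈ S}

lemma dset_eq (j : ℤ) (S : Set ℤ) :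
    dset j S = ⋃ m ∈ S, Set.Ico ((2:ℝ)^j * (m:ℝ)) ((2:ℝ)^j * (m+1)) := by
  ext x
  simp only [dset, Set.mem_ofPred_eq, Set.mem_iUnion, mem_Ico_iff]
  simp

lemma measurableSet_dset (j : ℤ) (S : Set ℤ) : MeasurableSet (dset j S) := by
  rw [dset_eq]
  exact MeasurableSet.biUnion (Set.to_countable _) fun _ _ => measurableSet_Ico

lemma vol_Ico (k m : ℤ) :
    volume (Set.Ico ((2:ℝ)^k * (m:ℝ)) ((2:ℝ)^k * (m+1))) = ENNReal.ofReal ((2:ℝ)^k) := by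
  rw [Real.volume_Ico]; congr 1; ring

lemma lam_le (g : ℝ → ℝ≥0∞) (lam : ℝ≥0∞) (j : ℤ) (S : Set ℤ) (hS : ∀ m ∈ S, lam < avg g j m) :
    lam * volume (dset j S) ≤ ∫⁻ u in dset j S, g u := by
  have hd : S.PairwiseDisjoint (fun m : ℤ => Set.Ico ((2:ℝ)^j * (m:ℝ)) ((2:ℝ)^j * (m+1))) := by
    intro a _ b _ hab
    rw [Function.onFun, Set.disjoint_left]
    intro x hx hy
    exact hab (((mem_Ico_iff x j a).1 hx).symm.trans ((mem_Ico_iff x j b).1 hy))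
  rw [dset_eq, measure_biUnion (Set.to_countable _) hd (fun _ _ => measurableSet_Ico),
    lintegral_biUnion (Set.to_countable _) (fun _ _ => measurableSet_Ico) hd,
    ← ENNReal.tsum_mul_left]
  refine ENNReal.tsum_le_tsum fun m => ?_
  have h := (hS m.1 m.2).le
  rw [vol_Ico]
  have h0 : ENNReal.ofReal ((2:ℝ)^j) ≠ 0 := by simpa using two_zpow_pos j
  calc lam * ENNReal.ofReal ((2:ℝ)^j) ≤ avg g j m * ENNReal.ofReal ((2:ℝ)^j) := by gcongr
    _ = _ := by
      rw [avg, mul_comm, ← mul_assoc, ENNReal.mul_inv_cancel h0 ofReal_ne_top, one_mul]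

lemma vol_shift (F : Set ℝ) (s : ℝ) : volume {x | x + s ∈ F} = volume F := by
  exact measure_preimage_add_right volume s F

lemma vol_shifts (j n : ℤ) (S : Set ℤ) (L : ℕ) (hL : n.natAbs ≤ 2 ^ L) :
    volume (⋃ i : ℕ, {x : ℝ | x + n * (2:ℝ)^(j - (i:ℤ)) ∈ dset j S})
      ≤ ((L : ℝ≥0∞) + 3) * volume (dset j S) := by
  have hsub : (⋃ i : ℕ, {x : ℝ | x + n * (2:ℝ)^(j - (i:ℤ)) ∈ dset j S}) ⊆
      (⋃ i ∈ Finset.range L, {x : ℝ | x + n * (2:ℝ)^(j - (i:ℤ)) ∈ dset j S}) ∪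
      (⋃ e ∈ ({-1, 0, 1} : Finset ℤ), {x : ℝ | x + e * (2:ℝ)^j ∈ dset j S}) := by
    intro x hx
    obtain ⟨i, hi⟩ := Set.mem_iUnion.1 hx
    by_cases h : i < L
    · left; simp only [Set.mem_iUnion]; exact ⟨i, by simpa using h, hi⟩
    right
    push Not at h
    have hp := two_zpow_pos j
    set t : ℝ := n / 2 ^ i with ht
    have ht1 : |t| ≤ 1 := by
      rw [ht, abs_div, abs_of_pos (by positivity : (0:ℝ) < 2 ^ i), div_le_one (by positivity)]
      have : (n.natAbs : ℝ) ≤ 2 ^ i := by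
        exact_mod_cast hL.trans (Nat.pow_le_pow_right (by norm_num) h)
      rwa [Nat.cast_natAbs, Int.cast_abs] at this
    have hx' : ⌊x / (2:ℝ)^j + t⌋ ∈ S := by
      have : (x + n * (2:ℝ)^(j - (i:ℤ))) / (2:ℝ)^j = x / (2:ℝ)^j + t := by
        rw [zpow_sub₀ (by norm_num), zpow_natCast, ht]; field_simp
      rw [← this]; exact hi
    have hfl (e : ℤ) : ⌊(x + e * (2:ℝ)^j) / (2:ℝ)^j⌋ = ⌊x / (2:ℝ)^j⌋ + e := by
      rw [add_div, mul_div_cancel_right₀ _ hp.ne', Int.floor_add_intCast]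
    have key : ∃ e ∈ ({-1, 0, 1} : Finset ℤ), ⌊x / (2:ℝ)^j + t⌋ = ⌊x / (2:ℝ)^j⌋ + e := by
      have h1 := abs_le.1 ht1
      have l : ⌊x / (2:ℝ)^j⌋ - 1 ≤ ⌊x / (2:ℝ)^j + t⌋ := by
        rw [Int.le_floor]; push_cast; linarith [Int.floor_le (x / (2:ℝ)^j)]
      have u : ⌊x / (2:ℝ)^j + t⌋ < ⌊x / (2:ℝ)^j⌋ + 2 := by
        rw [Int.floor_lt]; push_cast; linarith [Int.lt_floor_add_one (x / (2:ℝ)^j)]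
      refine ⟨⌊x / (2:ℝ)^j + t⌋ - ⌊x / (2:ℝ)^j⌋, ?_, by ring⟩
      simp only [Finset.mem_insert, Finset.mem_singleton]; omega
    obtain ⟨e, he, hk⟩ := key
    simp only [Set.mem_iUnion]
    refine ⟨e, he, ?_⟩
    show ⌊(x + e * (2:ℝ)^j) / (2:ℝ)^j⌋ ∈ S
    rw [hfl, ← hk]; exact hx'
  refine (measure_mono hsub).trans ((measure_union_le _ _).trans ?_)
  rw [add_mul]
  refine add_le_add ?_ ?_
  · refine (measure_biUnion_finset_le _ _).trans ?_
    simp [vol_shift]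
  · refine (measure_biUnion_finset_le _ _).trans ?_
    simp only [vol_shift]
    simp

lemma weak_trunc (g : ℝ → ℝ≥0∞) (lam : ℝ≥0∞) (n K : ℤ) (L : ℕ) (hL : n.natAbs ≤ 2 ^ L) :
    lam * volume {x : ℝ | ∃ k ≤ K, lam < avg g k (⌊x / (2:ℝ)^k⌋ + n)}
      ≤ ((L : ℝ≥0∞) + 3) * ∫⁻ u, g u := by
  let S : ℤ → Set ℤ := fun j => {m | j ≤ K ∧ lam < avg g j m ∧
    ∀ i : ℕ, 0 < i → j + (i:ℤ) ≤ K → avg g (j + (i:ℤ)) (m / 2 ^ i) ≤ lam}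
  have hdisj : Pairwise (Function.onFun Disjoint fun j => dset j (S j)) := by
    have : ∀ j j' : ℤ, j < j' → Disjoint (dset j (S j)) (dset j' (S j')) := by
      intro j j' hjj
      rw [Set.disjoint_left]
      intro x hx hx'
      obtain ⟨i, hi⟩ := Int.le.dest hjj.le
      have h1 := hx.2.2 i (by omega) (by rw [hi]; exact hx'.1)
      rw [← floor_nest, hi] at h1
      exact absurd hx'.2.1 (not_lt.2 h1)
    intro j j' hne
    rcases lt_or_gt_of_ne hne with h | h
    · exact this _ _ h
    · exact (this _ _ h).symm
  have hsub : {x : ℝ | ∃ k ≤ K, lam < avg g k (⌊x / (2:ℝ)^k⌋ + n)} ⊆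
      ⋃ j : ℤ, ⋃ i : ℕ, {x : ℝ | x + n * (2:ℝ)^(j - (i:ℤ)) ∈ dset j (S j)} := by
    rintro x ⟨k, hk, hx⟩
    have hp := two_zpow_pos k
    set y := x + n * (2:ℝ)^k with hy
    have hfl : ⌊y / (2:ℝ)^k⌋ = ⌊x / (2:ℝ)^k⌋ + n := by
      rw [hy, add_div, mul_div_cancel_right₀ _ hp.ne', Int.floor_add_intCast]
    rw [← hfl] at hx
    obtain ⟨j, ⟨hjK, hj⟩, hmax⟩ := Int.exists_greatest_of_bdd
      (P := fun j => j ≤ K ∧ lam < avg g j ⌊y / (2:ℝ)^j⌋) ⟨K, fun z hz => hz.1⟩ ⟨k, hk, hx⟩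
    have hkj := hmax k ⟨hk, hx⟩
    obtain ⟨i, hi⟩ := Int.le.dest hkj
    simp only [Set.mem_iUnion]
    refine ⟨j, i, ?_⟩
    have hji : j - (i:ℤ) = k := by omega
    rw [Set.mem_ofPred_eq, hji, ← hy]
    refine ⟨hjK, hj, fun l hl hlK => ?_⟩
    rw [← floor_nest]
    by_contra hcon
    push Not at hcon
    have := hmax _ ⟨hlK, hcon⟩
    omega
  calc lam * volume {x : ℝ | ∃ k ≤ K, lam < avg g k (⌊x / (2:ℝ)^k⌋ + n)}
      ≤ lam * ∑' j : ℤ, ((L : ℝ≥0∞) + 3) * volume (dset j (S j)) := by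
        gcongr
        refine (measure_mono hsub).trans ((measure_iUnion_le _).trans ?_)
        exact ENNReal.tsum_le_tsum fun j => vol_shifts j n (S j) L hL
    _ = ((L : ℝ≥0∞) + 3) * ∑' j : ℤ, lam * volume (dset j (S j)) := by
        rw [ENNReal.tsum_mul_left, ENNReal.tsum_mul_left]; ring
    _ ≤ ((L : ℝ≥0∞) + 3) * ∑' j : ℤ, ∫⁻ u in dset j (S j), g u := by
        gcongr with j
        exact lam_le g lam j (S j) fun m hm => hm.2.1
    _ = ((L : ℝ≥0∞) + 3) * ∫⁻ u in ⋃ j, dset j (S j), g u := by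
        rw [lintegral_iUnion (fun j => measurableSet_dset j _) hdisj]
    _ ≤ _ := by
        exact mul_le_mul_right (setLIntegral_le_lintegral _ _) _

noncomputable def mx (n : ℤ) (g : ℝ → ℝ≥0∞) (x : ℝ) : ℝ≥0∞ :=
  ⨆ k : ℤ, avg g k (⌊x / (2:ℝ)^k⌋ + n)

lemma weak (g : ℝ → ℝ≥0∞) (lam : ℝ≥0∞) (n : ℤ) (L : ℕ) (hL : n.natAbs ≤ 2 ^ L) :
    lam * volume {x : ℝ | lam < mx n g x} ≤ ((L : ℝ≥0∞) + 3) * ∫⁻ u, g u := by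
  have h : {x : ℝ | lam < mx n g x} =
      ⋃ K : ℕ, {x : ℝ | ∃ k ≤ (K:ℤ), lam < avg g k (⌊x / (2:ℝ)^k⌋ + n)} := by
    ext x
    simp only [mx, lt_iSup_iff, Set.mem_ofPred_eq, Set.mem_iUnion]
    constructor
    · rintro ⟨k, hk⟩; exact ⟨k.toNat, k, Int.self_le_toNat k, hk⟩
    · rintro ⟨_, k, _, hk⟩; exact ⟨k, hk⟩
  have hm : Monotone fun K : ℕ => {x : ℝ | ∃ k ≤ (K:ℤ), lam < avg g k (⌊x / (2:ℝ)^k⌋ + n)} := by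
    rintro a b hab x ⟨k, hk, hx⟩
    exact ⟨k, hk.trans (by exact_mod_cast hab), hx⟩
  rw [h, hm.measure_iUnion, ENNReal.mul_iSup]
  exact iSup_le fun K => weak_trunc g lam n K L hL

lemma measurable_mx (n : ℤ) (g : ℝ → ℝ≥0∞) : Measurable (mx n g) := by
  refine Measurable.iSup fun k => ?_
  exact (measurable_from_top (f := fun m : ℤ => avg g k (m + n))).comp
    (Int.measurable_floor.comp (measurable_id.div_const _))

lemma avg_split (g : ℝ → ℝ≥0∞) (c : ℝ≥0∞) (k m : ℤ) :
    avg g k m ≤ avg ({u | c < g u}.indicator g) k m + c := by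
  have h0 : ENNReal.ofReal ((2:ℝ)^k) ≠ 0 := by simpa using two_zpow_pos k
  have hc : (ENNReal.ofReal ((2:ℝ)^k))⁻¹ *
      ∫⁻ u in Set.Ico ((2:ℝ)^k * m) ((2:ℝ)^k * (m+1)), c = c := by
    rw [setLIntegral_const, vol_Ico, mul_comm, mul_assoc,
      ENNReal.mul_inv_cancel h0 ofReal_ne_top, mul_one]
  refine le_of_le_of_eq ?_ (congrArg (fun z => avg ({u | c < g u}.indicator g) k m + z) hc)
  simp only [avg]
  rw [← mul_add, ← lintegral_add_right _ measurable_const]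
  gcongr with u
  by_cases h : c < g u
  · rw [Set.indicator_of_mem (by exact h)]; exact le_self_add
  · rw [Set.indicator_of_notMem (by exact h), zero_add]; exact not_lt.1 h

lemma mx_split (g : ℝ → ℝ≥0∞) (c : ℝ≥0∞) (n : ℤ) (x : ℝ) :
    mx n g x ≤ mx n ({u | c < g u}.indicator g) x + c := by
  refine iSup_le fun k => (avg_split g c _ _).trans ?_
  gcongr
  exact le_iSup (fun k => avg ({u | c < g u}.indicator g) k (⌊x / (2:ℝ)^k⌋ + n)) k

lemma lint_pow (q b : ℝ) (hq : 0 < q) (hb : 0 ≤ b) :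
    ∫⁻ t in Set.Ioo 0 b, ENNReal.ofReal (t ^ (q - 1)) = ENNReal.ofReal (b ^ q / q) := by
  have h1 : IntervalIntegrable (fun t : ℝ => t ^ (q - 1)) volume 0 b :=
    intervalIntegral.intervalIntegrable_rpow' (by linarith)
  rw [intervalIntegrable_iff_integrableOn_Ioo_of_le hb] at h1
  rw [← ofReal_integral_eq_lintegral_ofReal h1, ← integral_Ioc_eq_integral_Ioo,
    ← intervalIntegral.integral_of_le hb, integral_rpow (Or.inl (by linarith))]
  · rw [sub_add_cancel, Real.zero_rpow hq.ne', sub_zero]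
  · filter_upwards [ae_restrict_mem measurableSet_Ioo] with t ht
    exact Real.rpow_nonneg ht.1.le _

/-- the layer function -/
noncomputable def lay (q : ℝ) (a : ℝ≥0∞) : ℝ≥0∞ :=
  ∫⁻ t in Set.Ioi (0:ℝ), ENNReal.ofReal (t ^ (q - 1)) * {t : ℝ | ENNReal.ofReal t < a}.indicator 1 t

lemma lay_ofReal (q b : ℝ) (hq : 0 < q) (hb : 0 ≤ b) :
    lay q (ENNReal.ofReal b) = ENNReal.ofReal (b ^ q / q) := by
  rw [← lint_pow q b hq hb, lay, ← lintegral_indicator measurableSet_Ioi,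
    ← lintegral_indicator measurableSet_Ioo]
  congr 1
  ext t
  by_cases h : 0 < t
  · by_cases h2 : t < b
    · simp [h, h2, ENNReal.ofReal_lt_ofReal_iff (h.trans h2), Set.indicator]
    · have : ¬ ENNReal.ofReal t < ENNReal.ofReal b :=
        not_lt.2 (ENNReal.ofReal_le_ofReal (not_lt.1 h2))
      simp [h, h2, this, Set.indicator]
  · simp [h, Set.indicator]

lemma lay_mono (q : ℝ) {a b : ℝ≥0∞} (h : a ≤ b) : lay q a ≤ lay q b := by
  unfold lay
  gcongr with t

lemma lay_eq (q : ℝ) (hq : 0 < q) (a : ℝ≥0∞) :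
    ENNReal.ofReal q * lay q a = a ^ q := by
  have hfin : ∀ b : ℝ, 0 ≤ b → ENNReal.ofReal q * lay q (ENNReal.ofReal b) = ENNReal.ofReal b ^ q := by
    intro b hb
    rw [lay_ofReal q b hq hb, ← ENNReal.ofReal_mul hq.le, mul_div_cancel₀ _ hq.ne',
      ENNReal.ofReal_rpow_of_nonneg hb hq.le]
  by_cases ha : a = ⊤
  · rw [ha, ENNReal.top_rpow_of_pos hq]
    refine ENNReal.eq_top_of_forall_nnreal_le ?_
    intro r
    have h := hfin ((r:ℝ) ^ (q⁻¹)) (by positivity)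
    rw [ENNReal.ofReal_rpow_of_nonneg (by positivity) hq.le, ← Real.rpow_mul (by positivity),
      inv_mul_cancel₀ hq.ne', Real.rpow_one, ENNReal.ofReal_coe_nnreal] at h
    rw [← h]
    gcongr
    exact lay_mono q le_top
  · rw [← ENNReal.ofReal_toReal ha]
    exact hfin _ ENNReal.toReal_nonneg

lemma lay_meas (q : ℝ) (h : ℝ → ℝ≥0∞) (hh : Measurable h) :
    Measurable fun z : ℝ × ℝ => ENNReal.ofReal (z.2 ^ (q - 1)) *
      {t : ℝ | ENNReal.ofReal t < h z.1}.indicator (1 : ℝ → ℝ≥0∞) z.2 := by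
  refine Measurable.mul (by fun_prop) ?_
  have hs : MeasurableSet {z : ℝ × ℝ | ENNReal.ofReal z.2 < h z.1} :=
    measurableSet_lt (by fun_prop) (by fun_prop)
  exact (measurable_const (a := (1:ℝ≥0∞))).indicator hs

lemma strong (p : ℝ) (hp : 1 < p) (g : ℝ → ℝ≥0∞) (hg : Measurable g) (n : ℤ) (L : ℕ)
    (hL : n.natAbs ≤ 2 ^ L) :
    ∫⁻ x, mx n g x ^ p ≤ ENNReal.ofReal (p / (p - 1) * 2 ^ p) * ((L : ℝ≥0∞) + 3) * ∫⁻ x, g x ^ p := by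
  have hp0 : 0 < p := by linarith
  have hp1 : 0 < p - 1 := by linarith
  set c : ℝ≥0∞ := (L : ℝ≥0∞) + 3 with hc
  have hM := measurable_mx n g
  -- pointwise in t
  have hpt : ∀ t : ℝ, 0 < t → ENNReal.ofReal (t ^ (p - 1)) * volume {x | ENNReal.ofReal t < mx n g x}
      ≤ 2 * c * ∫⁻ u, g u * (ENNReal.ofReal (t ^ (p - 1 - 1)) *
        {t : ℝ | ENNReal.ofReal t < 2 * g u}.indicator (1 : ℝ → ℝ≥0∞) t) := by
    intro t ht
    set a := ENNReal.ofReal (t / 2) with ha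
    have hta : ENNReal.ofReal t = a + a := by
      rw [ha, ← ENNReal.ofReal_add (by positivity) (by positivity), add_halves]
    have hv : volume {x | ENNReal.ofReal t < mx n g x} ≤
        volume {x | a < mx n ({u | a < g u}.indicator g) x} := by
      refine measure_mono fun x hx => ?_
      have h1 : ENNReal.ofReal t < mx n g x := hx
      have := h1.trans_le (mx_split g a n x)
      rw [hta] at this
      exact lt_of_add_lt_add_right this
    have hw := weak ({u | a < g u}.indicator g) a n L hL
    have ht1 : ENNReal.ofReal (t ^ (p - 1)) = 2 * ENNReal.ofReal (t ^ (p - 1 - 1)) * a := by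
      have : t ^ (p - 1) = 2 * t ^ (p - 1 - 1) * (t / 2) := by
        rw [Real.rpow_sub_one ht.ne' (p - 1)]; field_simp
      rw [this, ENNReal.ofReal_mul (by positivity), ENNReal.ofReal_mul (by positivity)]
      simp [ha]
    calc _ ≤ 2 * ENNReal.ofReal (t ^ (p - 1 - 1)) *
          (a * volume {x | a < mx n ({u | a < g u}.indicator g) x}) := by
          rw [ht1, mul_assoc]; gcongr
      _ ≤ 2 * ENNReal.ofReal (t ^ (p - 1 - 1)) * (c * ∫⁻ u, {u | a < g u}.indicator g u) := by
          gcongr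
      _ = 2 * c * (ENNReal.ofReal (t ^ (p - 1 - 1)) * ∫⁻ u, {u | a < g u}.indicator g u) := by ring
      _ ≤ _ := by
          rw [← lintegral_const_mul' _ _ ofReal_ne_top]
          refine mul_le_mul_right (lintegral_mono fun u => ?_) _
          by_cases h : a < g u
          · have h2 : ENNReal.ofReal t < 2 * g u := by
              rw [hta, two_mul]; exact ENNReal.add_lt_add h h
            rw [Set.indicator_of_mem (by exact h), Set.indicator_of_mem (by exact h2)]
            simp [mul_comm]
          · rw [Set.indicator_of_notMem (by exact h)]; simp
  have e1 : ∫⁻ x, mx n g x ^ p = ENNReal.ofReal p * ∫⁻ t in Set.Ioi (0:ℝ),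
      ENNReal.ofReal (t ^ (p - 1)) * volume {x | ENNReal.ofReal t < mx n g x} := by
    simp_rw [← lay_eq p hp0]
    rw [lintegral_const_mul' _ _ ofReal_ne_top]
    congr 1
    unfold lay
    rw [lintegral_lintegral_swap (lay_meas p _ hM).aemeasurable]
    refine lintegral_congr fun t => ?_
    rw [lintegral_const_mul' _ _ ofReal_ne_top]
    congr 1
    have hs : MeasurableSet {x | ENNReal.ofReal t < mx n g x} :=
      measurableSet_lt measurable_const hM
    rw [← lintegral_indicator_one hs]
    rfl
  rw [e1]
  calc _ ≤ ENNReal.ofReal p * ∫⁻ t in Set.Ioi (0:ℝ), 2 * c * ∫⁻ u, g u *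
        (ENNReal.ofReal (t ^ (p - 1 - 1)) *
        {t : ℝ | ENNReal.ofReal t < 2 * g u}.indicator (1 : ℝ → ℝ≥0∞) t) :=
        mul_le_mul_right (setLIntegral_mono' measurableSet_Ioi fun t ht => hpt t ht) _
    _ = ENNReal.ofReal p * (2 * c * ∫⁻ u, g u * lay (p - 1) (2 * g u)) := by
        have hc' : 2 * c ≠ ⊤ := ENNReal.mul_ne_top (by simp) (by simp [hc])
        rw [lintegral_const_mul' _ _ hc']
        congr 2
        rw [lintegral_lintegral_swap]
        · refine lintegral_congr fun u => ?_
          unfold lay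
          rw [lintegral_const_mul]
          exact (lay_meas (p-1) (fun u => 2 * g u) (by fun_prop)).comp (measurable_prodMk_left (x := u))
        · refine Measurable.aemeasurable ?_
          exact Measurable.mul (by fun_prop) ((lay_meas (p-1) (fun u => 2 * g u) (by fun_prop)).comp measurable_swap)
    _ = ENNReal.ofReal (p / (p - 1) * 2 ^ p) * c * ∫⁻ x, g x ^ p := by
        have hl : ∀ a : ℝ≥0∞, a * lay (p - 1) (2 * a) =
            ENNReal.ofReal ((p - 1)⁻¹ * 2 ^ (p - 1)) * a ^ p := by
          intro a
          have h1 := lay_eq (p - 1) hp1 (2 * a)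
          have h2 : lay (p - 1) (2 * a) = ENNReal.ofReal (p - 1)⁻¹ * (2 * a) ^ (p - 1) := by
            rw [← h1, ← mul_assoc, ← ENNReal.ofReal_mul (by positivity), inv_mul_cancel₀ hp1.ne']
            simp
          have h3 : a ^ p = a * a ^ (p - 1) := by
            conv_lhs => rw [show p = 1 + (p - 1) by ring]
            rw [ENNReal.rpow_add_of_nonneg _ _ (by norm_num) hp1.le, ENNReal.rpow_one]
          rw [h2, h3, ENNReal.mul_rpow_of_nonneg _ _ hp1.le, ENNReal.ofReal_mul (by positivity),
            ← ENNReal.ofReal_rpow_of_nonneg (by norm_num) hp1.le]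
          simp only [ENNReal.ofReal_ofNat]
          ring
        simp_rw [hl]
        rw [lintegral_const_mul' _ _ ofReal_ne_top]
        have : p / (p - 1) * 2 ^ p = p * (2 * ((p - 1)⁻¹ * 2 ^ (p - 1))) := by
          rw [Real.rpow_sub_one (by norm_num)]; field_simp
        rw [this, ENNReal.ofReal_mul hp0.le, ENNReal.ofReal_mul (p := 2) (by norm_num)]
        simp only [ENNReal.ofReal_ofNat]
        ring

lemma measurable_avg_prod (n k : ℤ) (H : ℝ × ℝ → ℝ≥0∞) (hH : Measurable H) :
    Measurable fun w : ℝ × ℤ => avg (fun u => H (w.1, u)) k (w.2 + n) := by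
  refine measurable_from_prod_countable_left fun m => ?_
  have h3 : Measurable fun a : ℝ =>
      ∫⁻ u in Set.Ico ((2:ℝ)^k * ((m + n : ℤ):ℝ)) ((2:ℝ)^k * (((m + n : ℤ):ℝ)+1)), H (a, u) :=
    Measurable.lintegral_prod_right' (ν := volume.restrict
      (Set.Ico ((2:ℝ)^k * ((m + n : ℤ):ℝ)) ((2:ℝ)^k * (((m + n : ℤ):ℝ)+1)))) hH
  exact h3.const_mul _

lemma measurable_mx_prod (n : ℤ) (H : ℝ × ℝ → ℝ≥0∞) (hH : Measurable H) :
    Measurable fun z : ℝ × ℝ => mx n (fun u => H (z.1, u)) z.2 := by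
  have hk : ∀ k : ℤ, Measurable fun z : ℝ × ℝ =>
      avg (fun u => H (z.1, u)) k (⌊z.2 / (2:ℝ)^k⌋ + n) := by
    intro k
    have h2 : Measurable fun z : ℝ × ℝ => (z.1, ⌊z.2 / (2:ℝ)^k⌋) :=
      Measurable.prodMk measurable_fst
        (Measurable.floor (Measurable.div_const measurable_snd _))
    have h3 := (measurable_avg_prod n k H hH).comp h2
    simpa only [Function.comp_def] using h3
  unfold mx
  exact Measurable.iSup hk

lemma measurable_mx_prod' (n : ℤ) (H : ℝ × ℝ → ℝ≥0∞) (hH : Measurable H) :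
    Measurable fun z : ℝ × ℝ => mx n (fun u => H (u, z.2)) z.1 := by
  have h1 : Measurable fun w : ℝ × ℝ => H (w.2, w.1) := by
    have := hH.comp measurable_swap
    simpa only [Function.comp_def, Prod.swap] using this
  have h2 := (measurable_mx_prod n (fun w => H (w.2, w.1)) h1).comp measurable_swap
  simpa only [Function.comp_def, Prod.swap] using h2

lemma bound_L (n : ℤ) : ∃ L : ℕ, n.natAbs ≤ 2 ^ L ∧
    (L : ℝ) + 3 ≤ 5 / Real.log 2 * Real.log (2 + |(n:ℝ)|) := by
  refine ⟨Nat.log 2 n.natAbs + 1, (Nat.lt_pow_succ_log_self (by norm_num) _).le, ?_⟩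
  have h2 : 0 < Real.log 2 := Real.log_pos (by norm_num)
  have hl : Real.log 2 ≤ Real.log (2 + |(n:ℝ)|) :=
    Real.log_le_log (by norm_num) (by linarith [abs_nonneg (n:ℝ)])
  have hk : (Nat.log 2 n.natAbs : ℝ) * Real.log 2 ≤ Real.log (2 + |(n:ℝ)|) := by
    by_cases hn : n = 0
    · simp [hn]; positivity
    · have h := Nat.pow_log_le_self 2 (x := n.natAbs) (by simpa using hn)
      have h' : (2:ℝ) ^ (Nat.log 2 n.natAbs) ≤ |(n:ℝ)| := by
        have : ((2 ^ (Nat.log 2 n.natAbs) : ℕ) : ℝ) ≤ (n.natAbs : ℝ) := by exact_mod_cast h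
        rw [Nat.cast_natAbs, Int.cast_abs] at this
        simpa using this
      rw [← Real.log_pow]
      exact Real.log_le_log (by positivity) (by linarith)
  push_cast
  rw [div_mul_eq_mul_div, le_div_iff₀ h2]
  nlinarith

lemma bound_L' (p : ℝ) (hp : 1 < p) : ∃ D : ℝ, 0 < D ∧ ∀ n : ℤ, ∃ L : ℕ, n.natAbs ≤ 2 ^ L ∧
    (L : ℝ) + 3 ≤ D * (Real.log (2 + |(n:ℝ)|) ^ 2) ^ p := by
  have h2 : 0 < Real.log 2 := Real.log_pos (by norm_num)
  refine ⟨5 / Real.log 2 / Real.log 2 ^ (2 * p - 1), by positivity, fun n => ?_⟩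
  obtain ⟨L, h, hL⟩ := bound_L n
  refine ⟨L, h, hL.trans ?_⟩
  have hl : Real.log 2 ≤ Real.log (2 + |(n:ℝ)|) :=
    Real.log_le_log (by norm_num) (by linarith [abs_nonneg (n:ℝ)])
  set l := Real.log (2 + |(n:ℝ)|) with hldef
  have hl0 : 0 < l := h2.trans_le hl
  have e : (l ^ 2) ^ p = l * l ^ (2 * p - 1) := by
    rw [← Real.rpow_natCast, ← Real.rpow_mul hl0.le, Real.rpow_sub_one hl0.ne']
    push_cast; field_simp
  rw [e]
  have hmono : Real.log 2 ^ (2 * p - 1) ≤ l ^ (2 * p - 1) :=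
    Real.rpow_le_rpow h2.le hl (by linarith)
  have hpos : 0 < Real.log 2 ^ (2 * p - 1) := by positivity
  calc 5 / Real.log 2 * l = 5 / Real.log 2 / Real.log 2 ^ (2 * p - 1) * (l * Real.log 2 ^ (2 * p - 1)) := by
        field_simp
    _ ≤ _ := by gcongr

end BiShift

open BiShift in
lemma biShifted_le (n₁ n₂ : ℤ) (f : ℝ × ℝ → ℂ) (hf : Measurable f) (z : ℝ × ℝ) :
    biShiftedMaximal n₁ n₂ f z ≤
      mx n₁ (fun u => mx n₂ (fun v => (‖f (u, v)‖₊ : ℝ≥0∞)) z.2) z.1 := by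
  unfold biShiftedMaximal
  refine iSup_le fun k₁ => iSup_le fun m₁ => iSup_le fun k₂ => iSup_le fun m₂ =>
    iSup_le fun h₁ => iSup_le fun h₂ => ?_
  rw [mem_Ico_iff] at h₁ h₂
  refine le_trans ?_ (le_iSup (fun k => avg (fun u => mx n₂ (fun v => (‖f (u, v)‖₊ : ℝ≥0∞)) z.2) k
    (⌊z.1 / (2:ℝ)^k⌋ + n₁)) k₁)
  rw [h₁]
  have hin : ∀ u, avg (fun v => (‖f (u, v)‖₊ : ℝ≥0∞)) k₂ (m₂ + n₂) ≤
      mx n₂ (fun v => (‖f (u, v)‖₊ : ℝ≥0∞)) z.2 := by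
    intro u
    refine le_of_eq_of_le ?_ (le_iSup (fun k => avg (fun v => (‖f (u, v)‖₊ : ℝ≥0∞)) k
      (⌊z.2 / (2:ℝ)^k⌋ + n₂)) k₂)
    rw [h₂]
  have h0 : ∀ k : ℤ, ENNReal.ofReal ((2:ℝ)^k) ≠ 0 := fun k => by simpa using two_zpow_pos k
  refine le_trans (le_of_eq ?_) (mul_le_mul_right (lintegral_mono hin) _)
  rw [ENNReal.ofReal_mul (by positivity), ENNReal.mul_inv (Or.inl (h0 _)) (Or.inl ofReal_ne_top)]
  unfold avg
  rw [lintegral_const_mul' _ _ (ENNReal.inv_ne_top.2 (h0 _)), ← mul_assoc]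
  congr 1
  rw [Measure.volume_eq_prod, ← Measure.prod_restrict, lintegral_prod _ (by fun_prop)]
  push_cast
  rfl

open BiShift

/-- The biparameter shifted maximal operator `M_{n₁}M_{n₂}` is bounded on
`L^p(ℝ²)`, `1 < p < ∞`, with norm at most `C_p log²⟨n₁⟩ log²⟨n₂⟩` (stated with both sides of
the norm inequality raised to the power `p`), `⟨m⟩ = 2 + |m|`. -/
theorem stmt16 (p : ℝ) (hp : 1 < p) :
    ∃ C : ℝ, 0 < C ∧ ∀ (n₁ n₂ : ℤ) (f : ℝ × ℝ → ℂ), Measurable f →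
      ∫⁻ z : ℝ × ℝ, (biShiftedMaximal n₁ n₂ f z) ^ p ≤
        ENNReal.ofReal
            (C * (Real.log (2 + |(n₁ : ℝ)|)) ^ 2 * (Real.log (2 + |(n₂ : ℝ)|)) ^ 2) ^ p *
          ∫⁻ z : ℝ × ℝ, ((‖f z‖₊ : ℝ≥0∞)) ^ p := by
  have hp0 : 0 < p := by linarith
  have hp1 : 0 < p - 1 := by linarith
  obtain ⟨D, hD, hb⟩ := bound_L' p hp
  set A : ℝ := p / (p - 1) * 2 ^ p with hA
  have hA0 : 0 < A := by positivity
  refine ⟨((A * D) * (A * D)) ^ p⁻¹, by positivity, fun n₁ n₂ f hf => ?_⟩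
  obtain ⟨L₁, hL₁, hB₁⟩ := hb n₁
  obtain ⟨L₂, hL₂, hB₂⟩ := hb n₂
  set l₁ := Real.log (2 + |(n₁ : ℝ)|) ^ 2
  set l₂ := Real.log (2 + |(n₂ : ℝ)|) ^ 2
  have hl₁ : 0 ≤ l₁ := sq_nonneg _
  have hl₂ : 0 ≤ l₂ := sq_nonneg _
  obtain ⟨F, hF⟩ : ∃ F : ℝ × ℝ → ℝ≥0∞, F = fun z => (‖f z‖₊ : ℝ≥0∞) := ⟨_, rfl⟩
  have hFm : Measurable F := by rw [hF]; fun_prop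
  obtain ⟨G, hG⟩ : ∃ G : ℝ × ℝ → ℝ≥0∞, G = fun z => mx n₂ (fun v => F (z.1, v)) z.2 := ⟨_, rfl⟩
  have hGm : Measurable G := by rw [hG]; exact measurable_mx_prod n₂ F hFm
  have hle : ∀ z, biShiftedMaximal n₁ n₂ f z ≤ mx n₁ (fun u => G (u, z.2)) z.1 := by
    intro z; rw [hG, hF]; exact biShifted_le n₁ n₂ f hf z
  have hGst : ∀ x, ∫⁻ y, G (x, y) ^ p ≤ ENNReal.ofReal A * ((L₂ : ℝ≥0∞) + 3) * ∫⁻ y, F (x, y) ^ p := by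
    intro x
    rw [hG]
    exact strong p hp (fun v => F (x, v)) (hFm.comp measurable_prodMk_left) n₂ L₂ hL₂
  have hFe : ∫⁻ z : ℝ × ℝ, ((‖f z‖₊ : ℝ≥0∞)) ^ p = ∫⁻ z, F z ^ p := by rw [hF]
  rw [hFe]
  have hHm : Measurable fun z : ℝ × ℝ => mx n₁ (fun u => G (u, z.2)) z.1 :=
    measurable_mx_prod' n₁ G hGm
  have hconst : ∀ L : ℕ, ∀ l : ℝ, (L : ℝ) + 3 ≤ D * l ^ p →
      ENNReal.ofReal A * ((L : ℝ≥0∞) + 3) ≤ ENNReal.ofReal (A * D * l ^ p) := by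
    intro L l h
    have : ((L : ℝ≥0∞) + 3) = ENNReal.ofReal ((L:ℝ) + 3) := by
      rw [ENNReal.ofReal_add (by positivity) (by norm_num)]; simp
    rw [this, ← ENNReal.ofReal_mul hA0.le, mul_assoc A D]
    exact ENNReal.ofReal_le_ofReal (mul_le_mul_of_nonneg_left h hA0.le)
  calc ∫⁻ z : ℝ × ℝ, (biShiftedMaximal n₁ n₂ f z) ^ p
      ≤ ∫⁻ z : ℝ × ℝ, (mx n₁ (fun u => G (u, z.2)) z.1) ^ p := by
        gcongr with z
        exact hle z
    _ = ∫⁻ y, ∫⁻ x, (mx n₁ (fun u => G (u, y)) x) ^ p := by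
        rw [Measure.volume_eq_prod, lintegral_prod_symm' _ (hHm.pow_const p)]
    _ ≤ ∫⁻ y, ENNReal.ofReal (A * D * l₁ ^ p) * ∫⁻ x, G (x, y) ^ p := by
        gcongr with y
        refine (strong p hp (fun u => G (u, y)) (hGm.comp measurable_prodMk_right) n₁ L₁ hL₁).trans ?_
        gcongr
        exact hconst _ _ hB₁
    _ = ENNReal.ofReal (A * D * l₁ ^ p) * ∫⁻ x, ∫⁻ y, G (x, y) ^ p := by
        rw [lintegral_const_mul' _ _ ofReal_ne_top]
        congr 1
        refine lintegral_lintegral_swap (f := fun y x => G (x, y) ^ p) (Measurable.aemeasurable ?_)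
        have := (hGm.pow_const p).comp (measurable_swap (α := ℝ) (β := ℝ))
        simpa only [Function.comp_def, Prod.swap, Function.uncurry_def] using this
    _ ≤ ENNReal.ofReal (A * D * l₁ ^ p) *
          ∫⁻ x, ENNReal.ofReal (A * D * l₂ ^ p) * ∫⁻ y, F (x, y) ^ p := by
        gcongr with x
        refine (hGst x).trans ?_
        gcongr
        exact hconst _ _ hB₂
    _ = ENNReal.ofReal (A * D * l₁ ^ p) * ENNReal.ofReal (A * D * l₂ ^ p) * ∫⁻ z, F z ^ p := by
        rw [lintegral_const_mul' _ _ ofReal_ne_top, Measure.volume_eq_prod,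
          lintegral_prod _ (hFm.pow_const p).aemeasurable]
        ring
    _ = _ := by
        congr 1
        rw [ENNReal.ofReal_rpow_of_nonneg (by positivity) hp0.le, ← ENNReal.ofReal_mul (by positivity),
          Real.mul_rpow (by positivity) hl₂, Real.mul_rpow (by positivity) hl₁,
          ← Real.rpow_mul (by positivity), inv_mul_cancel₀ hp0.ne', Real.rpow_one]
        congr 1
        ring
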